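/- Let S be a completely Archimedean semiring. Then every generalized additive idempotent pure congruence on S is contained in 𝒴; hence 𝒴 is the greatest generalized additive idempotent pure congruence on S. -/

import Mathlib

/-- A "semiring" in the sense of the paper: both reducts are semigroups
(no commutativity, no identities) and multiplication distributes over
addition on both sides. -/
class PSemiring (S : Type*) extends AddSemigroup S, Semigroup S where
  left_distrib : ∀ a b c : S, a * (b + c) = a * b + a * c
  right_distrib : ∀ a b c : S, (a + b) * c = a * c + b * c

namespace PSemiring

variable {S : Type*} [PSemiring S]

/-- `nmul n a` is the `(n+1)`-fold sum `a + ⋯ + a`; thus the positive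
multiple `m·a` of the paper is `nmul (m-1) a`. -/
def nmul : ℕ → S → S
  | 0, a => a
  | n + 1, a => nmul n a + a

/-- `a` is additively regular. -/
def AddRegular (a : S) : Prop := ∃ x, a + x + a = a

/-- `a` is a completely regular element. -/
def CompletelyRegularElem (a : S) : Prop :=
  ∃ x, a = a + x + a ∧ a + x = x + a ∧ a * (a + x) = a + x

/-- `S` is a quasi completely regular semiring. -/
def QuasiCompletelyRegular (S : Type*) [PSemiring S] : Prop :=
  ∀ a : S, ∃ n : ℕ, CompletelyRegularElem (nmul n a)

/-- `S` is a completely regular semiring. -/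
def CompletelyRegularSemiring (S : Type*) [PSemiring S] : Prop :=
  ∀ a : S, CompletelyRegularElem a

/-- `e` is an additive idempotent (i.e. `e ∈ E⁺(S)`). -/
def AddIdem (e : S) : Prop := e + e = e

/-- `V⁺(a)`, the set of additive inverses of `a`. -/
def Vplus (a : S) : Set S := {x | a + x + a = a ∧ x + a + x = x}

/-- `{a} ∪ (S + a)`. -/
def lset (a : S) : Set S := insert a {x | ∃ s, x = s + a}

/-- `{a} ∪ (a + S)`. -/
def rset (a : S) : Set S := insert a {x | ∃ s, x = a + s}

/-- `{a} ∪ (S + a) ∪ (a + S) ∪ (S + a + S)`. -/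
def jset (a : S) : Set S :=
  insert a ({x | ∃ s, x = s + a} ∪ {x | ∃ s, x = a + s} ∪ {x | ∃ s t, x = s + a + t})

/-- Green's relation `L⁺` on the additive reduct. -/
def GreenL (a b : S) : Prop := lset a = lset b

/-- Green's relation `R⁺` on the additive reduct. -/
def GreenR (a b : S) : Prop := rset a = rset b

/-- Green's relation `J⁺` on the additive reduct. -/
def GreenJ (a b : S) : Prop := jset a = jset b

/-- `n` is the least index such that the `(n+1)`-fold sum of `a` is additively
regular, i.e. `(n+1)·a` is the least additively regular positive multiple. -/
def LeastReg (a : S) (n : ℕ) : Prop :=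
  AddRegular (nmul n a) ∧ ∀ m < n, ¬ AddRegular (nmul m a)

/-- The relation `L*⁺`. -/
def LStar (a b : S) : Prop :=
  ∃ p q, LeastReg a p ∧ LeastReg b q ∧ GreenL (nmul p a) (nmul q b)

/-- The relation `R*⁺`. -/
def RStar (a b : S) : Prop :=
  ∃ p q, LeastReg a p ∧ LeastReg b q ∧ GreenR (nmul p a) (nmul q b)

/-- The relation `J*⁺`. -/
def JStar (a b : S) : Prop :=
  ∃ p q, LeastReg a p ∧ LeastReg b q ∧ GreenJ (nmul p a) (nmul q b)

/-- `H*⁺ = L*⁺ ∩ R*⁺`. -/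
def HStar (a b : S) : Prop := LStar a b ∧ RStar a b

/-- `D*⁺ = L*⁺ ∘ R*⁺` (relational composition). -/
def DStar (a b : S) : Prop := ∃ c, LStar a c ∧ RStar c b

/-- `z = 0_a`: `z = na + x` where `n` is the least positive integer with `na`
completely regular and `x` is the (unique) element with `na = na+x+na`,
`x = x+na+x` and `na+x = x+na`. -/
def IsZeroOf (a z : S) : Prop :=
  ∃ n x, (CompletelyRegularElem (nmul n a) ∧
      ∀ m < n, ¬ CompletelyRegularElem (nmul m a)) ∧
    nmul n a = nmul n a + x + nmul n a ∧ x = x + nmul n a + x ∧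
    nmul n a + x = x + nmul n a ∧ z = nmul n a + x

/-- The relation `𝒴`, relative to a choice `z` of the map `a ↦ 0_a`. -/
def Yrel (z : S → S) (a b : S) : Prop := Vplus (a + z a) = Vplus (b + z b)

/-- A (semiring) congruence. -/
structure IsCong (r : S → S → Prop) : Prop where
  refl : ∀ a, r a a
  symm : ∀ {a b}, r a b → r b a
  trans : ∀ {a b c}, r a b → r b c → r a c
  addl : ∀ (c : S) {a b}, r a b → r (c + a) (c + b)
  addr : ∀ (c : S) {a b}, r a b → r (a + c) (b + c)
  mull : ∀ (c : S) {a b}, r a b → r (c * a) (c * b)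
  mulr : ∀ (c : S) {a b}, r a b → r (a * c) (b * c)

/-- `r` is a b-lattice congruence: `S/r` is a b-lattice. -/
def IsBLatticeCong (r : S → S → Prop) : Prop :=
  IsCong r ∧ (∀ a : S, r (a * a) a) ∧ (∀ a : S, r (a + a) a) ∧
    ∀ a b : S, r (a + b) (b + a)

/-- `r` is the least b-lattice congruence. -/
def IsLeastBLatticeCong (r : S → S → Prop) : Prop :=
  IsBLatticeCong r ∧ ∀ r', IsBLatticeCong r' → ∀ a b, r a b → r' a b

/-- `r` is a skew-ring congruence: `S/r` is a semiring whose additive reduct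
is a group (expressed by solvability of both translation equations). -/
def IsSkewRingCong (r : S → S → Prop) : Prop :=
  IsCong r ∧ ∀ a b : S, (∃ x, r (a + x) b) ∧ ∃ y, r (y + a) b

/-- `r` is the least skew-ring congruence. -/
def IsLeastSkewRingCong (r : S → S → Prop) : Prop :=
  IsSkewRingCong r ∧ ∀ r', IsSkewRingCong r' → ∀ a b, r a b → r' a b

/-- `η` is a b-lattice-of-skew-rings congruence: `S/η` admits a congruence `ξ`
(given here as a congruence on `S` containing `η`) such that `(S/η)/ξ` is a
b-lattice and every `ξ`-class of `S/η` is a subsemiring whose additive reduct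
is a group. -/
def IsBLSRCong (η : S → S → Prop) : Prop :=
  IsCong η ∧ ∃ ξ : S → S → Prop, IsCong ξ ∧ (∀ a b, η a b → ξ a b) ∧
    (∀ a : S, ξ (a * a) a) ∧ (∀ a : S, ξ (a + a) a) ∧
    (∀ a b : S, ξ (a + b) (b + a)) ∧
    (∀ a b, ξ a b → ξ (a + b) a ∧ ξ (a * b) a) ∧
    ∀ a b, ξ a b → (∃ x, ξ x a ∧ η (a + x) b) ∧ ∃ y, ξ y a ∧ η (y + a) b

/-- `ν` is the least b-lattice-of-skew-rings congruence. -/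
def IsLeastBLSRCong (ν : S → S → Prop) : Prop :=
  IsBLSRCong ν ∧ ∀ η, IsBLSRCong η → ∀ a b, ν a b → η a b

/-- `r` is a completely regular semiring congruence: `S/r` is completely
regular. -/
def IsCRCong (r : S → S → Prop) : Prop :=
  IsCong r ∧ ∀ a : S, ∃ x, r a (a + x + a) ∧ r (a + x) (x + a) ∧
    r (a * (a + x)) (a + x)

/-- `ρ` is the least completely regular semiring congruence. -/
def IsLeastCRCong (r : S → S → Prop) : Prop :=
  IsCRCong r ∧ ∀ r', IsCRCong r' → ∀ a b, r a b → r' a b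

/-- `S` is quasi-orthodox. -/
def QuasiOrthodox (S : Type*) [PSemiring S] : Prop :=
  ∀ e f : S, AddIdem e → AddIdem f →
    ∃ n : ℕ, nmul n (e + f) = nmul (n + 1) (e + f)

/-- `S` is a completely Archimedean semiring. -/
def CompletelyArchimedean (S : Type*) [PSemiring S] : Prop :=
  QuasiCompletelyRegular S ∧ ∀ a b : S, JStar a b

/-- `r` is the least congruence containing the relation `τ`. -/
def IsLeastCongContaining (τ r : S → S → Prop) : Prop :=
  IsCong r ∧ (∀ a b, τ a b → r a b) ∧
    ∀ r', IsCong r' → (∀ a b, τ a b → r' a b) → ∀ a b, r a b → r' a b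

/-- `r` is a generalized additive idempotent pure congruence (purity part). -/
def GenAddIdemPure (r : S → S → Prop) : Prop :=
  ∀ a e : S, AddIdem e → r a e → ∃ n : ℕ, nmul n a = nmul (n + 1) a

/-- `τ^e`: `a = x + c + y`, `b = x + d + y` for some `(c,d) ∈ τ`, where each of
`x`, `y` may also be absent (i.e. `x, y ∈ S⁰`). -/
def relE (τ : S → S → Prop) (a b : S) : Prop :=
  ∃ c d, τ c d ∧ ((a = c ∧ b = d) ∨ (∃ x, a = x + c ∧ b = x + d) ∨
    (∃ y, a = c + y ∧ b = d + y) ∨ ∃ x y, a = x + c + y ∧ b = x + d + y)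

/-- `τ^♮`: the transitive closure of `(τ ∪ τ⁻¹ ∪ ε)^e`. -/
def natClosure (τ : S → S → Prop) : S → S → Prop :=
  Relation.TransGen (relE (fun a b => τ a b ∨ τ b a ∨ a = b))

end PSemiring

namespace PSemiring

/-- The semiring with the reversed addition. -/
abbrev addReverse {S : Type*} (_ : PSemiring S) : PSemiring S where
  add a b := b + a
  add_assoc a b c := (add_assoc c b a).symm
  mul a b := a * b
  mul_assoc := mul_assoc
  left_distrib a b c := left_distrib a c b
  right_distrib a b c := right_distrib b a c

/-- The semiring with the reversed multiplication. -/
abbrev mulReverse {S : Type*} (_ : PSemiring S) : PSemiring S where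
  add a b := a + b
  add_assoc := add_assoc
  mul a b := b * a
  mul_assoc a b c := (mul_assoc c b a).symm
  left_distrib a b c := right_distrib b c a
  right_distrib a b c := left_distrib c a b

/-- A map `z` behaving like `a ↦ 0_a` on a completely Archimedean semiring; the list of
properties is invariant under reversing either operation. -/
structure IsZeroMap {S : Type*} [PSemiring S] (z : S → S) : Prop where
  idem : ∀ a, AddIdem (z a)
  comm : ∀ a, a + z a = z a + a
  eq_add_right : ∀ a, ∃ x, z a = a + x
  eq_add_left : ∀ a, ∃ x, z a = x + a
  zero_add : ∀ (a : S) {v : S}, AddIdem v → z (a + v) + (a + v) = a + v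
  add_zero : ∀ (a : S) {v : S}, AddIdem v → (v + a) + z (v + a) = v + a
  right_inv : ∀ (s : S) {e : S}, AddIdem e → ∃ t, (e + s + e) + t = e
  left_inv : ∀ (s : S) {e : S}, AddIdem e → ∃ t, t + (e + s + e) = e
  idem_mul : ∀ (a : S) {e : S}, AddIdem e → e * a = e * z a
  mul_idem : ∀ (a : S) {e : S}, AddIdem e → a * e = z a * e
  mul_self : ∀ {e : S}, AddIdem e → e * e = e

/-- `a` and `b` agree once additive idempotents are added on both sides. -/
def SandwichEq {S : Type*} [PSemiring S] (a b : S) : Prop :=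
  ∀ u v, AddIdem u → AddIdem v → u + a + v = u + b + v

variable {S : Type*} [i : PSemiring S]

theorem AddIdem.mul_right {e : S} (he : AddIdem e) (a : S) : AddIdem (e * a) := by
  unfold AddIdem at *
  rw [← right_distrib, he]

theorem AddIdem.mul_left {e : S} (he : AddIdem e) (a : S) : AddIdem (a * e) := by
  unfold AddIdem at *
  rw [← left_distrib, he]

namespace IsZeroMap

variable {z : S → S}

theorem add_reverse (h : IsZeroMap z) : @IsZeroMap S (addReverse i) z :=
  @IsZeroMap.mk S (addReverse i) z h.idem (fun a => (h.comm a).symm) h.eq_add_left h.eq_add_right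
    h.add_zero h.zero_add
    (fun s e he => by
      obtain ⟨t, ht⟩ := h.left_inv s he
      exact ⟨t, (congrArg (t + ·) (add_assoc e s e).symm).trans ht⟩)
    (fun s e he => by
      obtain ⟨t, ht⟩ := h.right_inv s he
      exact ⟨t, (congrArg (· + t) (add_assoc e s e).symm).trans ht⟩)
    h.idem_mul h.mul_idem h.mul_self

theorem mul_reverse (h : IsZeroMap z) : @IsZeroMap S (mulReverse i) z :=
  @IsZeroMap.mk S (mulReverse i) z h.idem h.comm h.eq_add_right h.eq_add_left
    h.zero_add h.add_zero h.right_inv h.left_inv h.mul_idem h.idem_mul h.mul_self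

theorem eq_of_absorb (h : IsZeroMap z) {e f : S} (he : AddIdem e) (hf : AddIdem f)
    (h1 : e + f = f) (h2 : f + e = f) : f = e := by
  obtain ⟨t, ht⟩ := h.right_inv f he
  unfold AddIdem at *
  grind

theorem add_eq_of_add_eq_right (h : IsZeroMap z) {e f : S} (he : AddIdem e) (hf : AddIdem f)
    (hef : e + f = f) : f + e = e := by
  apply h.eq_of_absorb he <;> unfold AddIdem at * <;> grind

theorem add_eq_of_add_eq_left (h : IsZeroMap z) {e f : S} (he : AddIdem e) (hf : AddIdem f)
    (hef : e + f = e) : f + e = f := by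
  apply h.eq_of_absorb hf <;> unfold AddIdem at * <;> grind

theorem add_add_self_eq (h : IsZeroMap z) {e f : S} (he : AddIdem e)
    (hef : AddIdem (e + f + e)) : e + f + e = e := by
  apply h.eq_of_absorb he hef <;> unfold AddIdem at * <;> grind

theorem eq_of_mul_eq (h : IsZeroMap z) {a b : S} (hl : ∀ f, AddIdem f → f * a = f * b)
    (hr : ∀ f, AddIdem f → a * f = b * f) : z a = z b := by
  calc z a = z a * z b := by
        rw [← h.idem_mul b (h.idem a), ← hl _ (h.idem a), h.idem_mul a (h.idem a),
          h.mul_self (h.idem a)]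
    _ = z b := by
        rw [← h.mul_idem a (h.idem b), hr _ (h.idem b), h.mul_idem b (h.idem b),
          h.mul_self (h.idem b)]

theorem map_idem (h : IsZeroMap z) {e : S} (he : AddIdem e) : z e = e := by
  rw [← h.mul_self (h.idem e), ← h.mul_idem e (h.idem e), ← h.idem_mul e he, h.mul_self he]

theorem map_mul (h : IsZeroMap z) (a b : S) : z (a * b) = z a * z b := by
  rw [← h.map_idem ((h.idem a).mul_right (z b))]
  refine h.eq_of_mul_eq (fun f hf => ?_) fun f hf => ?_
  · rw [← mul_assoc, ← mul_assoc, ← h.idem_mul a hf, h.idem_mul b (hf.mul_right a)]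
  · rw [mul_assoc, mul_assoc, ← h.mul_idem b hf, h.mul_idem a (hf.mul_left b)]

theorem map_add_idem (h : IsZeroMap z) (a b : S) : z (a + b) = z (z a + z b) := by
  refine h.eq_of_mul_eq (fun f hf => ?_) fun f hf => ?_
  · rw [left_distrib, left_distrib, ← h.idem_mul a hf, ← h.idem_mul b hf]
  · rw [right_distrib, right_distrib, ← h.mul_idem a hf, ← h.mul_idem b hf]

theorem zero_add_map_add (h : IsZeroMap z) (a b : S) : z a + z (a + b) = z (a + b) := by
  obtain ⟨x, hx⟩ := h.eq_add_right (z a + z b)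
  have := h.map_add_idem a b
  have ha := h.idem a
  unfold AddIdem at ha
  grind

theorem map_add_add_zero (h : IsZeroMap z) (a b : S) : z (a + b) + z b = z (a + b) :=
  @zero_add_map_add S (addReverse i) z h.add_reverse b a

theorem zero_add_add (h : IsZeroMap z) (a : S) {v : S} (hv : AddIdem v) :
    z a + (a + v) = a + v := by
  rw [← h.zero_add a hv, ← add_assoc, h.zero_add_map_add]

theorem add_add_zero (h : IsZeroMap z) (a : S) {u : S} (hu : AddIdem u) :
    u + a + z a = u + a :=
  @zero_add_add S (addReverse i) z h.add_reverse a u hu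

/-- Elements related by `SandwichEq` behave the same way with respect to right translations. -/
theorem proportional (h : IsZeroMap z) {x y m m' e : S} (hxy : SandwichEq x y)
    (hm : AddIdem m) (hm' : AddIdem m') (he : AddIdem e) (hmm : m' + m = m)
    (hx : z x + m = z x) (hy : z y + m' = z y) : m + e = m' + e := by
  obtain ⟨r, hr⟩ := h.left_inv y hm'
  have h1 := hxy m' e hm' he
  have h2 := hxy m' m hm' hm
  have h3 := h.add_add_zero x hm'
  have h4 := h.add_add_zero y hm'
  have h5 : m' + x + m = m' + x := by rw [← h3, add_assoc, hx]
  have h6 : m' + y + m' = m' + y := by rw [← h4, add_assoc, hy]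
  rw [h6] at hr
  have h7 : m' + y + (m + e) = m' + y + e := by rw [← add_assoc, ← h2, h5, h1]
  have h8 : r + (m' + y + (m + e)) = r + (m' + y + e) := by rw [h7]
  rwa [← add_assoc r (m' + y), ← add_assoc r (m' + y), hr, ← add_assoc, hmm] at h8

theorem mul_sandwich_right (h : IsZeroMap z) {x y : S} (hxy : SandwichEq x y) (c : S) {u : S}
    (hu : AddIdem u) (huc : u + c * x + z c = u + c * y + z c) {v : S} (hv : AddIdem v) :
    u + c * x + v = u + c * y + v := by
  have key : ∀ w, AddIdem (z (v + w)) ∧ v + z (v + w) = z (v + w) ∧ z (v + w) + v = v ∧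
      z w + z (v + w) = z w := fun w => by
    have h1 : v + z (v + w) = z (v + w) := by
      have := h.zero_add_map_add v w
      rwa [h.map_idem hv] at this
    exact ⟨h.idem _, h1, h.add_eq_of_add_eq_right hv (h.idem _) h1,
      h.add_eq_of_add_eq_left (h.idem _) (h.idem _) (h.map_add_add_zero v w)⟩
  have hd : AddIdem (z c) := h.idem c
  have hdd := h.mul_self hd
  have key2 : ∀ w, ∃ k m, k = z c * z (v + w) ∧ AddIdem k ∧ AddIdem m ∧
      m = k + z (v + w) ∧ z w + m = z w ∧ k + m = m ∧ m + k = k ∧ k + z c + k = k ∧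
      u + c * w = u + c * w + k := fun w => by
    obtain ⟨h1, h2, h3, h4⟩ := key w
    have h5 := h.mul_self h1
    have hk : AddIdem (z c * z (v + w)) := hd.mul_right _
    have hm : z c * z (v + w) + z (v + w) = (z c + z (v + w)) * z (v + w) := by
      rw [right_distrib, h5]
    have hmi : AddIdem (z c * z (v + w) + z (v + w)) := by rw [hm]; exact h1.mul_left _
    have hkm : z c * z (v + w) + (z c * z (v + w) + z (v + w)) =
      z c * z (v + w) + z (v + w) := by rw [← add_assoc, hk]
    refine ⟨_, _, rfl, hk, hmi, rfl, ?_, hkm, h.add_eq_of_add_eq_right hk hmi hkm, ?_, ?_⟩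
    · have h6 : z (v + w) + z c * z (v + w) + z (v + w) = z (v + w) := by
        apply h.add_add_self_eq h1
        have : z (v + w) + z c * z (v + w) + z (v + w) =
          (z (v + w) + z c + z (v + w)) * z (v + w) := by
          rw [right_distrib, right_distrib, h5]
        rw [this]
        exact h1.mul_left _
      rw [← h4, add_assoc, ← add_assoc (z (v + w)), h6]
    · apply h.add_add_self_eq hk
      have : z c * z (v + w) + z c + z c * z (v + w) = z c * (z (v + w) + z c + z (v + w)) := by
        rw [left_distrib, left_distrib, hdd]
      rw [this]
      exact hd.mul_right _
    · conv_lhs => rw [← h.add_add_zero _ hu, h.map_mul, ← h4, left_distrib, ← h.map_mul,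
        ← add_assoc, h.add_add_zero _ hu]
  obtain ⟨hf, f1, f2, f3⟩ := key x
  obtain ⟨hg, g1, g2, g3⟩ := key y
  obtain ⟨k, m, hk, ki, mi, k1, k2, k3, k4, k5, k6⟩ := key2 x
  obtain ⟨l, n, hl, li, ni, l1, l2, l3, l4, l5, l6⟩ := key2 y
  have hgf : z (v + y) + z (v + x) = z (v + x) := by rw [← f1, ← add_assoc, g2]
  have hlk : l + k = k := by rw [hl, hk, ← left_distrib, hgf]
  have hnm : n + m = m := by
    calc n + m = n + l + k + m := by rw [add_assoc n l k, hlk, add_assoc n, k3]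
      _ = m := by rw [l4, hlk, k3]
  have hp := h.proportional hxy mi ni hf hnm k2 l2
  rw [← f2, ← add_assoc, ← add_assoc]
  congr 1
  clear key key2 hxy
  generalize u + c * x = X at *
  generalize u + c * y = Y at *
  generalize z (v + x) = e at *
  generalize z (v + y) = f at *
  generalize z c = d at *
  have hq : X + k = Y + k := by
    calc X + k = X + d + k := by
          rw [add_assoc, k6, add_assoc, add_assoc, ← add_assoc k, k5, ki]
      _ = Y + d + k := by rw [huc]
      _ = Y + (l + d + l) + k := by
          clear huc k5 k6 l5 hk hl f1 f2 f3 g1 g2 g3 hp hgf k1 l1 k2 l2 k3 k4 l3 l4 hnm hdd hf hg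
          unfold AddIdem at *
          grind
      _ = Y + k := by rw [l5, ← l6]
  calc X + e = Y + k + e := by rw [← hq, ← k6]
    _ = Y + (n + e) := by rw [add_assoc, ← k1, ← hp, k1, add_assoc, hf]
    _ = Y + e := by rw [l1, add_assoc, hgf, ← add_assoc, ← l6]

theorem mul_left_sandwich (h : IsZeroMap z) {x y : S} (hxy : SandwichEq x y) (c : S) :
    SandwichEq (c * x) (c * y) := by
  have hd := h.idem c
  have h0 : z c + c * x + z c = z c + c * y + z c := by
    have hc : c * z c = z c := by rw [h.mul_idem c hd, h.mul_self hd]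
    have := congrArg (c * ·) (hxy _ _ hd hd)
    simpa only [left_distrib, hc] using this
  intro u v hu hv
  have h1 := h.mul_sandwich_right hxy c hd h0 hv
  rw [add_assoc, add_assoc] at h1 ⊢
  refine @mul_sandwich_right S (addReverse i) z h.add_reverse x y ?_ c v hv h1 u hu
  intro u v hu hv
  have := hxy v u hv hu
  rwa [add_assoc, add_assoc] at this

theorem mul_right_sandwich (h : IsZeroMap z) {x y : S} (hxy : SandwichEq x y) (c : S) :
    SandwichEq (x * c) (y * c) :=
  @mul_left_sandwich S (mulReverse i) z h.mul_reverse x y hxy c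

theorem add_left_sandwich (h : IsZeroMap z) {x y : S} (hxy : SandwichEq x y) (c : S) :
    SandwichEq (c + x) (c + y) := by
  intro u v hu hv
  have h1 := hxy _ _ (h.idem c) hv
  have h2 := congrArg (u + c + ·) h1
  simp only [← add_assoc, h.add_add_zero c hu] at h2
  rwa [← add_assoc, ← add_assoc]

theorem add_right_sandwich (h : IsZeroMap z) {x y : S} (hxy : SandwichEq x y) (c : S) :
    SandwichEq (x + c) (y + c) := by
  intro u v hu hv
  have h1 := hxy _ _ hu (h.idem c)
  have h2 := congrArg (· + (c + v)) h1
  simp only [add_assoc, h.zero_add_add c hv] at h2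
  simpa only [add_assoc] using h2

theorem isCong_sandwichEq (h : IsZeroMap z) : IsCong (S := S) SandwichEq where
  refl _ _ _ _ _ := rfl
  symm hab u v hu hv := (hab u v hu hv).symm
  trans hab hbc u v hu hv := (hab u v hu hv).trans (hbc u v hu hv)
  addl c _ _ hab := h.add_left_sandwich hab c
  addr c _ _ hab := h.add_right_sandwich hab c
  mull c _ _ hab := h.mul_left_sandwich hab c
  mulr c _ _ hab := h.mul_right_sandwich hab c

theorem exists_inverse (h : IsZeroMap z) (a : S) {u v : S} (hu : AddIdem u) (hv : AddIdem v) :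
    ∃ w, v + w = w ∧ w + u = w ∧ u + a + v + w = u ∧ w + (u + a + v) = v := by
  obtain ⟨t, ht⟩ := h.right_inv (a + v) hu
  unfold AddIdem at hu hv
  have h1 : v + (v + u + t + u) = v + u + t + u := by grind
  have h2 : v + u + t + u + u = v + u + t + u := by grind
  have h3 : u + a + v + (v + u + t + u) = u := by grind
  refine ⟨v + u + t + u, h1, h2, h3, ?_⟩
  generalize v + u + t + u = w at *
  apply h.eq_of_absorb hv <;> (try unfold AddIdem) <;> grind

theorem eq_of_inverse (h : IsZeroMap z) {u v a b w : S} (hu : AddIdem u)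
    (h2 : w + u = w) (h4 : w + (u + a + v) = v)
    (hb : AddIdem (u + b + v + w)) (hv : AddIdem v) : u + a + v = u + b + v := by
  have : u + b + v + w = u := by
    apply h.eq_of_absorb hu hb <;> unfold AddIdem at * <;> grind
  unfold AddIdem at *
  grind

theorem sandwich_add_zero (h : IsZeroMap z) (a : S) {u v : S} (hu : AddIdem u) :
    u + (a + z a) + v = u + a + v := by
  rw [← add_assoc, h.add_add_zero a hu]

theorem add_zero_absorb (h : IsZeroMap z) (a : S) :
    z a + (a + z a) = a + z a ∧ a + z a + z a = a + z a := by
  have h1 := h.idem a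
  have h2 := h.comm a
  unfold AddIdem at h1
  constructor <;> grind

theorem regular_of_inverse (h : IsZeroMap z) {b w : S} (hw : w + (b + z b) + w = w) :
    b + z b + w + (b + z b) = b + z b := by
  obtain ⟨h1, h2⟩ := h.add_zero_absorb b
  have h3 := h.idem b
  have h4 : b + z b + w + z b = z b := by
    generalize b + z b = B at *
    apply h.eq_of_absorb h3 <;> unfold AddIdem at * <;> grind
  generalize b + z b = B at *
  grind

theorem vplus_subset (h : IsZeroMap z) {a b : S} (hab : SandwichEq a b) :
    Vplus (a + z a) ⊆ Vplus (b + z b) := by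
  rintro w ⟨h1, h2⟩
  have hu : AddIdem (a + z a + w) := by unfold AddIdem; grind
  have hv : AddIdem (w + (a + z a)) := by unfold AddIdem; grind
  have h3 := hab _ _ hu hv
  rw [← h.sandwich_add_zero a hu, ← h.sandwich_add_zero b hu] at h3
  have h4 : w + (b + z b) + w = w := by
    generalize b + z b = B at *
    generalize a + z a = A at *
    grind
  exact ⟨h.regular_of_inverse h4, h4⟩

theorem sandwichEq_of_vplus (h : IsZeroMap z) {a b : S}
    (hab : Vplus (a + z a) = Vplus (b + z b)) : SandwichEq a b := by
  intro u v hu hv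
  rw [← h.sandwich_add_zero a hu, ← h.sandwich_add_zero b hu]
  obtain ⟨w, h1, h2, h3, h4⟩ := h.exists_inverse (a + z a) hu hv
  have h5 : w + (a + z a) + w = w := by
    generalize a + z a = A at *
    grind
  have h6 : w ∈ Vplus (b + z b) := hab ▸ ⟨h.regular_of_inverse h5, h5⟩
  refine h.eq_of_inverse hu h2 h4 ?_ hv
  have h7 := h6.2
  generalize b + z b = B at *
  unfold AddIdem
  grind

theorem yrel_iff (h : IsZeroMap z) (a b : S) : Yrel z a b ↔ SandwichEq a b :=
  ⟨h.sandwichEq_of_vplus, fun hab => (h.vplus_subset hab).antisymm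
    (h.vplus_subset fun u v hu hv => (hab u v hu hv).symm)⟩

theorem isCong_yrel (h : IsZeroMap z) : IsCong (Yrel z) := by
  have : Yrel z = SandwichEq := funext₂ fun a b => propext (h.yrel_iff a b)
  exact this ▸ h.isCong_sandwichEq

theorem add_zero_eq_of_sandwichEq (h : IsZeroMap z) {a e : S} (he : AddIdem e)
    (hae : SandwichEq a e) : a + z a = z a := by
  obtain ⟨h1, h2⟩ := h.add_zero_absorb a
  have h3 := h.idem a
  have h4 := hae _ _ h3 h3
  have h5 := hae _ _ he h3
  apply h.eq_of_absorb h3 _ h1 h2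
  unfold AddIdem at *
  have h6 := h.comm a
  grind

theorem eq_of_nmul_eq (h : IsZeroMap z) {u b : S} (hu : AddIdem u) (h1 : u + b = b)
    (h2 : b + u = b) {n : ℕ} (hn : nmul n b = nmul (n + 1) b) : b = u := by
  obtain ⟨t, ht⟩ := h.right_inv b hu
  have hbt : b + t = u := by rwa [h1, h2] at ht
  have hnu : ∀ n, nmul n b + u = nmul n b := fun n => by
    cases n with
    | zero => exact h2
    | succ n => rw [nmul, add_assoc, h2]
  have h0 : b = b + b := by
    induction n with
    | zero => exact hn
    | succ n ih =>
      apply ih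
      have := congrArg (· + t) hn
      rw [nmul, nmul] at this
      simpa only [add_assoc, hbt, hnu] using this
  exact h.eq_of_absorb hu h0.symm h1 h2

theorem sandwichEq_of_pure (h : IsZeroMap z) {η : S → S → Prop} (hη : IsCong η)
    (hp : GenAddIdemPure η) {a b : S} (hab : η a b) : SandwichEq a b := by
  intro u v hu hv
  obtain ⟨w, h1, h2, h3, h4⟩ := h.exists_inverse a hu hv
  have h5 := hη.addr w (hη.addr v (hη.addl u (hη.symm hab)))
  rw [h3] at h5
  obtain ⟨n, hn⟩ := hp _ _ hu h5
  have h6 : u + b + v + w = u := by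
    refine h.eq_of_nmul_eq hu ?_ ?_ hn <;> unfold AddIdem at * <;> grind
  refine h.eq_of_inverse hu h2 h4 ?_ hv
  rwa [h6]

end IsZeroMap

theorem nmul_succ_left (n : ℕ) (a : S) : nmul (n + 1) a = a + nmul n a := by
  induction n with
  | zero => rfl
  | succ n ih =>
    change nmul (n + 1) a + a = a + (nmul n a + a)
    rw [ih, add_assoc]

theorem nmul_add_comm (n : ℕ) (a : S) : nmul n a + a = a + nmul n a := nmul_succ_left n a

theorem AddIdem.nmul_eq {e : S} (he : AddIdem e) (n : ℕ) : nmul n e = e := by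
  induction n with
  | zero => rfl
  | succ n ih => rw [nmul, ih, he]

theorem mul_nmul (n : ℕ) (c a : S) : c * nmul n a = nmul n (c * a) := by
  induction n with
  | zero => rfl
  | succ n ih => rw [nmul, left_distrib, ih, nmul]

theorem nmul_mul (n : ℕ) (a c : S) : nmul n a * c = nmul n (a * c) := by
  induction n with
  | zero => rfl
  | succ n ih => rw [nmul, right_distrib, ih, nmul]

theorem add_nmul_of_add {u a : S} (h : u + a = a) (n : ℕ) : u + nmul n a = nmul n a := by
  induction n with
  | zero => exact h
  | succ n ih => rw [nmul, ← add_assoc, ih]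

theorem nmul_add_of_add {u a : S} (h : a + u = a) (n : ℕ) : nmul n a + u = nmul n a := by
  cases n with
  | zero => exact h
  | succ n => rw [nmul, add_assoc, h]

theorem IsZeroOf.exists_nmul {a z : S} (h : IsZeroOf a z) : ∃ n x, nmul n a + x = z ∧
    x + nmul n a = z ∧ z + nmul n a = nmul n a ∧ nmul n a + z = nmul n a ∧ z + z = z := by
  obtain ⟨n, x, -, h1, h2, h3, h4⟩ := h
  refine ⟨n, x, ?_⟩
  generalize nmul n a = N at *
  subst h4
  refine ⟨rfl, h3.symm, h1.symm, ?_, ?_⟩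
  · rw [h3, ← add_assoc, ← h1]
  · rw [← add_assoc, ← h1]

theorem CompletelyArchimedean.exists_eq_add_add (hS : CompletelyArchimedean S) {e : S}
    (he : AddIdem e) (s : S) : ∃ l r, e = l + s + r := by
  obtain ⟨p, q, -, -, h⟩ := hS.2 e s
  have h1 : e ∈ jset (nmul q s) := by
    have : e ∈ jset (nmul p e) := by rw [he.nmul_eq]; exact Set.mem_insert _ _
    rwa [h] at this
  have h2 : ∃ l r, e = l + nmul q s + r := by
    unfold AddIdem at he
    rcases h1 with h1 | (⟨l, h1⟩ | ⟨r, h1⟩) | ⟨l, r, h1⟩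
    · exact ⟨e, e, by rw [← h1, he, he]⟩
    · exact ⟨l, e, by rw [← h1, he]⟩
    · exact ⟨e, r, by rw [add_assoc, ← h1, he]⟩
    · exact ⟨l, r, h1⟩
  obtain ⟨l, r, h2⟩ := h2
  cases q with
  | zero => exact ⟨l, r, h2⟩
  | succ q => exact ⟨l + nmul q s, r, by rwa [nmul, ← add_assoc l] at h2⟩

/-- Additive idempotents of a completely Archimedean semiring are primitive. -/
theorem CompletelyArchimedean.eq_of_absorb (hS : CompletelyArchimedean S) {z : S → S}
    (hz : ∀ a, IsZeroOf a (z a)) {e f : S} (he : AddIdem e) (hf : AddIdem f)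
    (h1 : e + f = f) (h2 : f + e = f) : f = e := by
  obtain ⟨l₀, r₀, h₀⟩ := hS.exists_eq_add_add he f
  obtain ⟨l, r, hlr, hl, hr⟩ : ∃ l r, l + r = e ∧ l + e = l ∧ f + r = r := by
    unfold AddIdem at he hf
    exact ⟨e + l₀ + f, f + r₀ + e, by grind, by grind, by grind⟩
  have hM : ∀ n, ∃ M, nmul n l + M = e ∧ f + M = M := fun n => by
    induction n with
    | zero => exact ⟨r, hlr, hr⟩
    | succ n ih =>
      obtain ⟨M, hM, hfM⟩ := ih
      refine ⟨r + M, ?_, by rw [← add_assoc, hr]⟩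
      rw [nmul, add_assoc, ← add_assoc l, hlr, ← hfM, ← add_assoc e, h1, hfM, hM]
  obtain ⟨n, x, k1, k2, k3, k4, k5⟩ := (hz l).exists_nmul
  obtain ⟨M, hM, hfM⟩ := hM n
  have hN := nmul_add_of_add hl n
  generalize nmul n l = N at *
  have hze : z l = e := by
    calc z l = z l + e := by rw [← k2, add_assoc, hN]
      _ = e := by rw [← hM, ← add_assoc, k3]
  have heM : e + M = M := by rw [← hfM, ← add_assoc, h1]
  have hMN : M + N = e := by
    rw [← heM, ← hze, ← k2, add_assoc x, hM, add_assoc, ← hze, k3]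
  rw [← h2, ← hMN, ← add_assoc, hfM]

theorem IsZeroOf.exists_eq_add_right {a z : S} (h : IsZeroOf a z) : ∃ x, z = a + x := by
  obtain ⟨n, x, h, -⟩ := h.exists_nmul
  cases n with
  | zero => exact ⟨x, h.symm⟩
  | succ n => exact ⟨nmul n a + x, by rw [← h, nmul_succ_left, add_assoc]⟩

theorem IsZeroOf.exists_eq_add_left {a z : S} (h : IsZeroOf a z) : ∃ x, z = x + a := by
  obtain ⟨n, x, -, h, -⟩ := h.exists_nmul
  cases n with
  | zero => exact ⟨x, h.symm⟩
  | succ n => exact ⟨x + nmul n a, by rw [← h, nmul, add_assoc]⟩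

theorem IsZeroOf.add_comm {a z : S} (h : IsZeroOf a z) : a + z = z + a := by
  obtain ⟨n, x, h1, h2, h3, h4, h5⟩ := h.exists_nmul
  have h6 := nmul_add_comm n a
  generalize nmul n a = N at *
  have h7 : a + z = N + a + x := by rw [← h1, ← add_assoc, h6]
  have h8 : z + a = x + a + N := by rw [← h2, add_assoc, h6, ← add_assoc]
  calc a + z = z + (a + z) := by rw [h7, ← add_assoc, ← add_assoc, h3]
    _ = z + a := by rw [← add_assoc, h8, add_assoc, h4]

theorem QuasiCompletelyRegular.mul_self (hS : QuasiCompletelyRegular S) {e : S}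
    (he : AddIdem e) : e * e = e := by
  obtain ⟨n, hn⟩ := hS e
  rw [he.nmul_eq] at hn
  obtain ⟨x, h1, h2, h3⟩ := hn
  have h4 : e + x = e := by
    conv_rhs => rw [h1, h2, add_assoc, he, ← h2]
  rwa [h4] at h3

theorem IsZeroOf.idem_mul {a z e : S} (h : IsZeroOf a z) (he : AddIdem e) :
    e * a = e * z := by
  obtain ⟨n, x, h1, h2, h3, h4, h5⟩ := h.exists_nmul
  have hn : e * nmul n a = e * a := by rw [mul_nmul, (he.mul_right a).nmul_eq]
  have h6 := he.mul_right a
  unfold AddIdem at h6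
  conv_rhs => rw [← h1, left_distrib, hn, ← h6, add_assoc, ← hn, ← left_distrib, h1,
    ← left_distrib, h4, hn]

theorem IsZeroOf.mul_idem {a z e : S} (h : IsZeroOf a z) (he : AddIdem e) :
    a * e = z * e := by
  obtain ⟨n, x, h1, h2, h3, h4, h5⟩ := h.exists_nmul
  have hn : nmul n a * e = a * e := by rw [nmul_mul, (he.mul_left a).nmul_eq]
  have h6 := he.mul_left a
  unfold AddIdem at h6
  conv_rhs => rw [← h1, right_distrib, hn, ← h6, add_assoc, ← hn, ← right_distrib, h1,
    ← right_distrib, h4, hn]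

theorem CompletelyArchimedean.isZeroMap (hS : CompletelyArchimedean S) {z : S → S}
    (hz : ∀ a, IsZeroOf a (z a)) : IsZeroMap z := by
  have idem : ∀ a, AddIdem (z a) := fun a => by
    obtain ⟨n, x, -, -, -, -, h⟩ := (hz a).exists_nmul
    exact h
  have zero_eq : ∀ s {e : S}, AddIdem e → z (e + s + e) = e := fun s e he => by
    apply hS.eq_of_absorb hz he (idem _)
    · obtain ⟨x, hx⟩ := (hz (e + s + e)).exists_eq_add_right
      rw [hx, ← add_assoc, ← add_assoc, ← add_assoc, he]
    · obtain ⟨x, hx⟩ := (hz (e + s + e)).exists_eq_add_left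
      rw [hx, add_assoc, add_assoc, he]
  have right_inv : ∀ s {e : S}, AddIdem e → ∃ t, (e + s + e) + t = e := fun s e he => by
    obtain ⟨x, hx⟩ := (hz (e + s + e)).exists_eq_add_right
    exact ⟨x, by rw [← hx, zero_eq s he]⟩
  have left_inv : ∀ s {e : S}, AddIdem e → ∃ t, t + (e + s + e) = e := fun s e he => by
    obtain ⟨x, hx⟩ := (hz (e + s + e)).exists_eq_add_left
    exact ⟨x, by rw [← hx, zero_eq s he]⟩
  refine ⟨idem, fun a => (hz a).add_comm, fun a => (hz a).exists_eq_add_right,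
    fun a => (hz a).exists_eq_add_left, fun a v hv => ?_, fun a v hv => ?_, right_inv, left_inv,
    fun a e he => (hz a).idem_mul he, fun a e he => (hz a).mul_idem he, hS.1.mul_self⟩
  · obtain ⟨t', ht'⟩ := right_inv a hv
    have hv' : a + v + v = a + v := by rw [add_assoc, hv]
    have key : ∀ m, ∃ t, nmul m (a + v) + t = a + v := fun m => by
      induction m with
      | zero => exact ⟨v, hv'⟩
      | succ m ih =>
        obtain ⟨t, ht⟩ := ih
        have hm := nmul_add_of_add hv' m
        refine ⟨t' + t, ?_⟩
        calc nmul m (a + v) + (a + v) + (t' + t)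
            = nmul m (a + v) + v + (a + v) + (t' + t) := by rw [hm]
          _ = nmul m (a + v) + (v + a + v + t') + t := by simp only [add_assoc]
          _ = a + v := by rw [ht', hm, ht]
    obtain ⟨n, x, -, -, h3, -, -⟩ := (hz (a + v)).exists_nmul
    obtain ⟨t, ht⟩ := key n
    calc z (a + v) + (a + v) = z (a + v) + (nmul n (a + v) + t) := by rw [ht]
      _ = a + v := by rw [← add_assoc, h3, ht]
  · obtain ⟨t', ht'⟩ := left_inv a hv
    have hv' : v + (v + a) = v + a := by rw [← add_assoc, hv]
    have key : ∀ m, ∃ t, t + nmul m (v + a) = v + a := fun m => by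
      induction m with
      | zero => exact ⟨v, hv'⟩
      | succ m ih =>
        obtain ⟨t, ht⟩ := ih
        have hm := add_nmul_of_add hv' m
        refine ⟨t + t', ?_⟩
        rw [nmul_succ_left]
        calc t + t' + (v + a + nmul m (v + a))
            = t + t' + (v + a + (v + nmul m (v + a))) := by rw [hm]
          _ = t + (t' + (v + a + v) + nmul m (v + a)) := by simp only [add_assoc]
          _ = v + a := by rw [ht', hm, ht]
    obtain ⟨n, x, -, -, -, h4, -⟩ := (hz (v + a)).exists_nmul
    obtain ⟨t, ht⟩ := key n
    calc (v + a) + z (v + a) = (t + nmul n (v + a)) + z (v + a) := by rw [ht]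
      _ = v + a := by rw [add_assoc, h4, ht]

theorem IsZeroOf.nmul_eq_nmul_succ {a z : S} (h : IsZeroOf a z) (ha : a + z = z) :
    ∃ n, nmul n a = nmul (n + 1) a := by
  obtain ⟨n, x, h1, h2, h3, h4, h5⟩ := h.exists_nmul
  have key : ∀ m, nmul m a + z = z := fun m => by
    induction m with
    | zero => exact ha
    | succ m ih => rw [nmul, add_assoc, ha, ih]
  have hn : nmul n a = z := by rw [← h4, key]
  exact ⟨n, by rw [nmul, hn, ← h.add_comm, ha]⟩

end PSemiring

open PSemiring

/-- On a completely Archimedean semiring `S`, every generalized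
additive idempotent pure congruence is contained in `𝒴`; hence `𝒴` is the
greatest generalized additive idempotent pure congruence on `S`. -/
theorem yrel_greatest_pure {S : Type*} [PSemiring S]
    (hS : CompletelyArchimedean S) (z : S → S) (hz : ∀ a, IsZeroOf a (z a)) :
    (∀ η : S → S → Prop, IsCong η → GenAddIdemPure η →
      ∀ a b : S, η a b → Yrel z a b) ∧
    IsCong (Yrel z) ∧ GenAddIdemPure (Yrel z) := by
  have h := hS.isZeroMap hz
  refine ⟨fun η hη hp a b hab => (h.yrel_iff a b).2 (h.sandwichEq_of_pure hη hp hab),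
    h.isCong_yrel, fun a e he hae => ?_⟩
  exact (hz a).nmul_eq_nmul_succ (h.add_zero_eq_of_sandwichEq he ((h.yrel_iff a e).1 hae))
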